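/- Let 0 ≤ k ≤ m and let f be a spanning forest of G_m with exactly c connected components. Then the sum, over all words w of length k over the alphabet {1,2,3}, of the number of connected components of the restriction π_w(f) equals (3/2)(3^k − 1) + c. Equivalently, Σ_{w ∈ {1,2,3}^k} (3 − #components of π_w(f)) = (3/2)(3^k + 1) − c. -/

import Mathlib

attribute [local instance] Classical.propDecidable

noncomputable section

/-- Points in the plane. -/
abbrev Pt : Type := ℝ × ℝ

/-- The three corner vertices `u₁ = (0,0)`, `u₂ = (1,0)`, `u₃ = (1/2, √3/2)`. -/
def cornerPt : Fin 3 → Pt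
  | 0 => (0, 0)
  | 1 => (1, 0)
  | 2 => (1 / 2, Real.sqrt 3 / 2)

/-- The similitude `ψ_i(x) = (x + u_i)/2`. -/
def psi (i : Fin 3) (x : Pt) : Pt := ((x.1 + (cornerPt i).1) / 2, (x.2 + (cornerPt i).2) / 2)

/-- Vertex set of the Sierpiński graph `G_n`. -/
def sierpV : ℕ → Finset Pt
  | 0 => {cornerPt 0, cornerPt 1, cornerPt 2}
  | n + 1 => (sierpV n).image (psi 0) ∪ (sierpV n).image (psi 1) ∪ (sierpV n).image (psi 2)

/-- Edge set of the Sierpiński graph `G_n`. -/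
def sierpE : ℕ → Finset (Sym2 Pt)
  | 0 => {s(cornerPt 0, cornerPt 1), s(cornerPt 1, cornerPt 2), s(cornerPt 2, cornerPt 0)}
  | n + 1 =>
      (sierpE n).image (Sym2.map (psi 0)) ∪ (sierpE n).image (Sym2.map (psi 1)) ∪
        (sierpE n).image (Sym2.map (psi 2))

/-- The simple graph spanned by a finite set of edges. -/
def graphOf (F : Finset (Sym2 Pt)) : SimpleGraph Pt := SimpleGraph.fromEdgeSet ↑F

/-- Spanning trees of `G_n`: acyclic edge subsets connecting all vertices of `G_n`. -/
def treeSet (n : ℕ) : Finset (Finset (Sym2 Pt)) :=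
  (sierpE n).powerset.filter fun F =>
    (graphOf F).IsAcyclic ∧ ∀ x ∈ sierpV n, ∀ y ∈ sierpV n, (graphOf F).Reachable x y

/-- `S_n^i` (with `i : Fin 3` zero-based): spanning forests of `G_n` with exactly two
components, one containing corner `i`, the other containing the two remaining corners. -/
def twoForestSet (n : ℕ) (i : Fin 3) : Finset (Finset (Sym2 Pt)) :=
  (sierpE n).powerset.filter fun F =>
    (graphOf F).IsAcyclic ∧
    (∀ j, j ≠ i → ¬ (graphOf F).Reachable (cornerPt i) (cornerPt j)) ∧
    (∀ j k, j ≠ i → k ≠ i → (graphOf F).Reachable (cornerPt j) (cornerPt k)) ∧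
    (∀ x ∈ sierpV n, ∃ j, (graphOf F).Reachable (cornerPt j) x)

/-- `R_n`: spanning forests of `G_n` with exactly three components, each containing
exactly one corner vertex. -/
def threeForestSet (n : ℕ) : Finset (Finset (Sym2 Pt)) :=
  (sierpE n).powerset.filter fun F =>
    (graphOf F).IsAcyclic ∧
    (∀ j k, j ≠ k → ¬ (graphOf F).Reachable (cornerPt j) (cornerPt k)) ∧
    (∀ x ∈ sierpV n, ∃ j, (graphOf F).Reachable (cornerPt j) x)

/-- Edges of the copy `ψ_i(G_n)` inside `G_{n+1}`. -/
def psiCellE (i : Fin 3) (n : ℕ) : Finset (Sym2 Pt) := (sierpE n).image (Sym2.map (psi i))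

/-- The class `T_n^i`: for `n ≥ 1`, spanning trees whose unique path from corner `i`
to any other corner `j` stays in `ψ_i(G_{n-1}) ∪ ψ_j(G_{n-1})`; for `n = 0` the
singleton consisting of the two edges of `G_0` incident with corner `i`. -/
def treeClass : ℕ → Fin 3 → Finset (Finset (Sym2 Pt))
  | 0, i => {(sierpE 0).filter fun e => cornerPt i ∈ e}
  | n + 1, i =>
      (treeSet (n + 1)).filter fun F =>
        ∀ j, j ≠ i → ∀ p : (graphOf F).Walk (cornerPt i) (cornerPt j), p.IsPath →
          ∀ e ∈ p.edges, e ∈ psiCellE i n ∪ psiCellE j n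

/-- `ψ_w = ψ_{w₁} ∘ ⋯ ∘ ψ_{w_k}` for a word `w` of length `k`. -/
def psiWord {k : ℕ} (w : Fin k → Fin 3) : Pt → Pt :=
  (List.ofFn w).foldr (fun i g => psi i ∘ g) id

/-- The restriction `π_w(F) = ψ_w^{-1}(F ∩ ψ_w(G_{m-k}))` of an edge set `F ⊆ E G_m`
to the `k`-part indexed by the word `w`, as a subgraph of `G_{m-k}`. -/
def restrictE {k : ℕ} (w : Fin k → Fin 3) (m : ℕ) (F : Finset (Sym2 Pt)) :
    Finset (Sym2 Pt) :=
  (sierpE (m - k)).filter fun e => Sym2.map (psiWord w) e ∈ F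

/-- Number of connected components of the subgraph with edge set `F`,
on the vertex set of `G_m`. -/
def ncomp (m : ℕ) (F : Finset (Sym2 Pt)) : ℕ :=
  Set.ncard {C : Set Pt | ∃ v ∈ sierpV m, C = {x : Pt | x ∈ sierpV m ∧ (graphOf F).Reachable v x}}

/-- Degree of `v` in the edge set `F`. -/
def degIn (F : Finset (Sym2 Pt)) (v : Pt) : ℕ := (F.filter fun e => v ∈ e).card

/-- The subgraph of `G_0` replacing a forest in `Q_1`, used in the trace construction. -/
def traceCell (g : Finset (Sym2 Pt)) : Finset (Sym2 Pt) :=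
  if g ∈ treeClass 1 0 then (sierpE 0).filter (fun e => cornerPt 0 ∈ e)
  else if g ∈ treeClass 1 1 then (sierpE 0).filter (fun e => cornerPt 1 ∈ e)
  else if g ∈ treeClass 1 2 then (sierpE 0).filter (fun e => cornerPt 2 ∈ e)
  else if g ∈ twoForestSet 1 0 then (sierpE 0).filter (fun e => cornerPt 0 ∉ e)
  else if g ∈ twoForestSet 1 1 then (sierpE 0).filter (fun e => cornerPt 1 ∉ e)
  else if g ∈ twoForestSet 1 2 then (sierpE 0).filter (fun e => cornerPt 2 ∉ e)
  else ∅

/-- The trace `Tr f ⊆ E G_n` of an edge set `f ⊆ E G_{n+1}`. -/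
def trace (n : ℕ) (f : Finset (Sym2 Pt)) : Finset (Sym2 Pt) :=
  Finset.univ.biUnion fun w : Fin n → Fin 3 =>
    (traceCell (restrictE w (n + 1) f)).image (Sym2.map (psiWord w))

/-- `Q_n = T_n ∪ S_n^1 ∪ S_n^2 ∪ S_n^3 ∪ R_n`. -/
def qSet (n : ℕ) : Finset (Finset (Sym2 Pt)) :=
  treeSet n ∪ twoForestSet n 0 ∪ twoForestSet n 1 ∪ twoForestSet n 2 ∪ threeForestSet n

/-- The cardinality of an image depends only on the kernel of the function. -/
theorem ncard_image_eq_of_kernel_eq {α β γ : Type*} (f : α → β) (g : α → γ) (S : Set α)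
    (h : ∀ x ∈ S, ∀ y ∈ S, f x = f y ↔ g x = g y) : (f '' S).ncard = (g '' S).ncard := by
  refine Set.ncard_congr (fun _ hb => g hb.choose) ?_ ?_ ?_
  · intro b hb
    exact ⟨_, hb.choose_spec.1, rfl⟩
  · intro b b' hb hb' heq
    rw [← hb.choose_spec.2, ← hb'.choose_spec.2]
    exact (h _ hb.choose_spec.1 _ hb'.choose_spec.1).2 heq
  · rintro _ ⟨x, hx, rfl⟩
    have hb : f x ∈ f '' S := ⟨x, hx, rfl⟩
    exact ⟨f x, hb, (h _ hb.choose_spec.1 _ hx).1 hb.choose_spec.2⟩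

/-- The part of `V` reachable from `x` in the graph `G`. -/
def reachIn {α : Type*} (V : Finset α) (G : SimpleGraph α) (x : α) : Set α :=
  {y | y ∈ V ∧ G.Reachable x y}

theorem reachIn_eq_iff {α : Type*} {V : Finset α} {G : SimpleGraph α} {x y : α} (hy : y ∈ V) :
    reachIn V G x = reachIn V G y ↔ G.Reachable x y := by
  constructor
  · intro h
    have : y ∈ reachIn V G x := h ▸ ⟨hy, .rfl⟩
    exact this.2
  · intro h
    ext z
    exact and_congr_right fun _ => ⟨h.symm.trans, h.trans⟩

theorem reachable_sup_edge_iff {α : Type*} {G : SimpleGraph α} {a b x y : α} :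
    (G ⊔ SimpleGraph.fromEdgeSet {s(a, b)}).Reachable x y ↔
      G.Reachable x y ∨ (G.Reachable x a ∧ G.Reachable b y) ∨
        (G.Reachable x b ∧ G.Reachable a y) := by
  have hle : G ≤ G ⊔ SimpleGraph.fromEdgeSet {s(a, b)} := le_sup_left
  constructor
  · rintro ⟨p⟩
    induction p with
    | nil => exact Or.inl .rfl
    | @cons u v w huv _ ih =>
      rw [SimpleGraph.sup_adj, SimpleGraph.fromEdgeSet_adj, Set.mem_singleton_iff,
        Sym2.eq_iff] at huv
      rcases huv with huv | ⟨⟨rfl, rfl⟩ | ⟨rfl, rfl⟩, -⟩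
      · rcases ih with h | ⟨h, h'⟩ | ⟨h, h'⟩
        · exact Or.inl (huv.reachable.trans h)
        · exact Or.inr (Or.inl ⟨huv.reachable.trans h, h'⟩)
        · exact Or.inr (Or.inr ⟨huv.reachable.trans h, h'⟩)
      · rcases ih with h | ⟨h, h'⟩ | ⟨h, h'⟩
        · exact Or.inr (Or.inl ⟨.rfl, h⟩)
        · exact Or.inr (Or.inl ⟨.rfl, h'⟩)
        · exact Or.inl h'
      · rcases ih with h | ⟨h, h'⟩ | ⟨h, h'⟩
        · exact Or.inr (Or.inr ⟨.rfl, h⟩)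
        · exact Or.inl h'
        · exact Or.inr (Or.inr ⟨.rfl, h'⟩)
  · have hab : (G ⊔ SimpleGraph.fromEdgeSet {s(a, b)}).Reachable a b := by
      by_cases h : a = b
      · rw [h]
      · exact SimpleGraph.Adj.reachable (by simp [h])
    rintro (h | ⟨h, h'⟩ | ⟨h, h'⟩)
    · exact h.mono hle
    · exact (h.mono hle).trans (hab.trans (h'.mono hle))
    · exact (h.mono hle).trans (hab.symm.trans (h'.mono hle))

/-- Joining two components by an edge lowers the number of components by one. -/
theorem ncard_reachIn_sup_edge {α : Type*} {V : Finset α} {G : SimpleGraph α} {a b : α}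
    (ha : a ∈ V) (hb : b ∈ V) (hab : ¬ G.Reachable a b) :
    (reachIn V (G ⊔ SimpleGraph.fromEdgeSet {s(a, b)}) '' V).ncard + 1 =
      (reachIn V G '' V).ncard := by
  set H := G ⊔ SimpleGraph.fromEdgeSet {s(a, b)} with hH
  set S : Set α := {x | x ∈ V ∧ ¬ G.Reachable x b} with hS
  have hGV : reachIn V G '' V = insert (reachIn V G b) (reachIn V G '' S) := by
    ext C
    constructor
    · rintro ⟨x, hx, rfl⟩
      by_cases h : G.Reachable x b
      · exact Or.inl ((reachIn_eq_iff hb).2 h)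
      · exact Or.inr ⟨x, ⟨hx, h⟩, rfl⟩
    · rintro (rfl | ⟨x, hx, rfl⟩)
      · exact ⟨b, hb, rfl⟩
      · exact ⟨x, hx.1, rfl⟩
  have hnot : reachIn V G b ∉ reachIn V G '' S := by
    rintro ⟨x, hx, h⟩
    exact hx.2 ((reachIn_eq_iff hb).1 h)
  have hfin : (reachIn V G '' S).Finite :=
    (V.finite_toSet.subset fun x hx => hx.1).image _
  have hHV : reachIn V H '' V = reachIn V H '' S := by
    refine Set.Subset.antisymm ?_ (Set.image_mono fun x hx => hx.1)
    rintro _ ⟨x, hx, rfl⟩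
    by_cases h : G.Reachable x b
    · refine ⟨a, ⟨ha, hab⟩, (reachIn_eq_iff hx).2 ?_⟩
      exact reachable_sup_edge_iff.2 (Or.inr (Or.inl ⟨.rfl, h.symm⟩))
    · exact ⟨x, ⟨hx, h⟩, rfl⟩
  rw [hGV, Set.ncard_insert_of_notMem hnot hfin, hHV]
  congr 1
  refine ncard_image_eq_of_kernel_eq _ _ _ fun x hx y hy => ?_
  rw [reachIn_eq_iff hy.1, reachIn_eq_iff hy.1, hH, reachable_sup_edge_iff]
  refine ⟨?_, Or.inl⟩
  rintro (h | ⟨-, h⟩ | ⟨h, -⟩)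
  · exact h
  · exact absurd h.symm hy.2
  · exact absurd h hx.2

/-- In a finite forest, the number of components plus the number of edges is the number of
vertices. -/
theorem ncard_reachIn_add_card_edges {α : Type*} (V : Finset α) (F : Finset (Sym2 α))
    (hV : ∀ e ∈ F, ∀ x ∈ e, x ∈ V) (hF : ∀ e ∈ F, ¬ e.IsDiag)
    (hac : (SimpleGraph.fromEdgeSet (F : Set (Sym2 α))).IsAcyclic) :
    (reachIn V (SimpleGraph.fromEdgeSet (F : Set (Sym2 α))) '' V).ncard + F.card = V.card := by
  induction F using Finset.induction_on with
  | empty =>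
    rw [Set.InjOn.ncard_image, Set.ncard_coe_finset, Finset.card_empty, add_zero]
    intro x _ y hy h
    simpa using (reachIn_eq_iff hy).1 h
  | @insert e F he ih =>
    induction e using Sym2.ind with
    | _ a b =>
      have hne : a ≠ b := by simpa using hF _ (Finset.mem_insert_self _ _)
      have hsup : SimpleGraph.fromEdgeSet ((insert s(a, b) F : Finset (Sym2 α)) : Set (Sym2 α)) =
          SimpleGraph.fromEdgeSet (F : Set (Sym2 α)) ⊔ SimpleGraph.fromEdgeSet {s(a, b)} := by
        rw [Finset.coe_insert, ← SimpleGraph.fromEdgeSet_union, Set.union_singleton]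
      rw [hsup] at hac ⊢
      have hnadj : ¬ (SimpleGraph.fromEdgeSet (F : Set (Sym2 α))).Adj a b := by
        simp [he]
      have hac' := SimpleGraph.isAcyclic_sup_fromEdgeSet_iff.1 hac
      have hnr : ¬ (SimpleGraph.fromEdgeSet (F : Set (Sym2 α))).Reachable a b := fun h => by
        rcases hac'.2 h with h | h
        · exact hne h
        · exact hnadj h
      have hih := ih (fun e h => hV e (Finset.mem_insert_of_mem h))
        (fun e h => hF e (Finset.mem_insert_of_mem h)) hac'.1
      have hcard := ncard_reachIn_sup_edge
        (hV _ (Finset.mem_insert_self _ _) a (Sym2.mem_mk_left a b))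
        (hV _ (Finset.mem_insert_self _ _) b (Sym2.mem_mk_right a b)) hnr
      rw [Finset.card_insert_of_notMem he]
      omega

/-- Barycentric coordinates with respect to the three corner vertices. -/
def baryc : Fin 3 → Pt → ℝ
  | 0 => fun x => 1 - x.1 - x.2 / Real.sqrt 3
  | 1 => fun x => x.1 - x.2 / Real.sqrt 3
  | 2 => fun x => 2 * x.2 / Real.sqrt 3

theorem baryc_cornerPt (i j : Fin 3) : baryc i (cornerPt j) = if i = j then 1 else 0 := by
  have h3 : Real.sqrt 3 ≠ 0 := by positivity
  fin_cases i <;> fin_cases j <;> simp [baryc, cornerPt] <;> field_simp <;> norm_num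

theorem baryc_psi (i j : Fin 3) (x : Pt) :
    baryc i (psi j x) = (baryc i x + if i = j then 1 else 0) / 2 := by
  rw [← baryc_cornerPt]
  fin_cases i <;> simp only [baryc, psi] <;> ring

theorem sum_baryc (x : Pt) : ∑ i, baryc i x = 1 := by
  simp only [Fin.sum_univ_three, baryc]
  ring

theorem eq_of_baryc_eq {x y : Pt} (h : ∀ i, baryc i x = baryc i y) : x = y := by
  have h3 : Real.sqrt 3 ≠ 0 := by positivity
  have h1 := h 1
  have h2 := h 2
  simp only [baryc] at h1 h2
  have hy : x.2 = y.2 := by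
    field_simp at h2
    linarith
  rw [hy] at h1
  exact Prod.ext (by linarith) hy

theorem mem_sierpV_succ {n : ℕ} {x : Pt} :
    x ∈ sierpV (n + 1) ↔ ∃ i, ∃ y ∈ sierpV n, psi i y = x := by
  simp only [sierpV, Finset.mem_union, Finset.mem_image, Fin.exists_fin_succ]
  simp [or_assoc]

theorem mem_sierpE_succ {n : ℕ} {e : Sym2 Pt} :
    e ∈ sierpE (n + 1) ↔ ∃ i, ∃ e' ∈ sierpE n, Sym2.map (psi i) e' = e := by
  simp only [sierpE, Finset.mem_union, Finset.mem_image, Fin.exists_fin_succ]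
  simp [or_assoc]

theorem psi_injective (i : Fin 3) : Function.Injective (psi i) := by
  intro x y h
  simp only [psi, Prod.mk.injEq] at h
  exact Prod.ext (by linarith [h.1]) (by linarith [h.2])

theorem psi_cornerPt_self (i : Fin 3) : psi i (cornerPt i) = cornerPt i := by
  simp [psi]

theorem psi_cornerPt_comm (i j : Fin 3) : psi i (cornerPt j) = psi j (cornerPt i) := by
  simp [psi, add_comm]

theorem cornerPt_mem_sierpV (n : ℕ) (i : Fin 3) : cornerPt i ∈ sierpV n := by
  induction n with
  | zero => fin_cases i <;> simp [sierpV]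
  | succ n ih => exact mem_sierpV_succ.2 ⟨i, _, ih, psi_cornerPt_self i⟩

theorem baryc_nonneg {n : ℕ} {x : Pt} (hx : x ∈ sierpV n) (i : Fin 3) : 0 ≤ baryc i x := by
  induction n generalizing x with
  | zero =>
    simp only [sierpV, Finset.mem_insert, Finset.mem_singleton] at hx
    rcases hx with rfl | rfl | rfl <;> rw [baryc_cornerPt] <;> split_ifs <;> norm_num
  | succ n ih =>
    obtain ⟨j, y, hy, rfl⟩ := mem_sierpV_succ.1 hx
    rw [baryc_psi]
    have := ih hy
    split_ifs <;> linarith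

theorem eq_cornerPt_of_baryc {n : ℕ} {x : Pt} (hx : x ∈ sierpV n) {i : Fin 3}
    (h : 1 ≤ baryc i x) : x = cornerPt i := by
  have hs := sum_baryc x
  have h0 := baryc_nonneg hx 0
  have h1 := baryc_nonneg hx 1
  have h2 := baryc_nonneg hx 2
  rw [Fin.sum_univ_three] at hs
  refine eq_of_baryc_eq fun j => ?_
  rw [baryc_cornerPt]
  fin_cases i <;> fin_cases j <;> simp at h ⊢ <;> linarith

/-- Distinct cells meet only in the image of a corner. -/
theorem eq_cornerPt_of_psi_eq {n : ℕ} {x y : Pt} (hx : x ∈ sierpV n) (hy : y ∈ sierpV n)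
    {i j : Fin 3} (hij : i ≠ j) (h : psi i x = psi j y) : x = cornerPt j := by
  refine eq_cornerPt_of_baryc hx ?_
  have hj := congrArg (baryc j) h
  rw [baryc_psi, baryc_psi, if_neg hij.symm, if_pos rfl] at hj
  linarith [baryc_nonneg hy j]

theorem image_psi_inter_image_psi (n : ℕ) {i j : Fin 3} (hij : i ≠ j) :
    (sierpV n).image (psi i) ∩ (sierpV n).image (psi j) = {psi i (cornerPt j)} := by
  ext z
  simp only [Finset.mem_inter, Finset.mem_image, Finset.mem_singleton]
  constructor
  · rintro ⟨⟨x, hx, rfl⟩, y, hy, h⟩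
    rw [eq_cornerPt_of_psi_eq hx hy hij h.symm]
  · rintro rfl
    exact ⟨⟨_, cornerPt_mem_sierpV n j, rfl⟩, _, cornerPt_mem_sierpV n i, psi_cornerPt_comm j i⟩

theorem cornerPt_injective : Function.Injective cornerPt := by
  intro i j h
  by_contra hij
  have := baryc_cornerPt i j
  rw [← h, baryc_cornerPt, if_pos rfl, if_neg hij] at this
  exact one_ne_zero this

theorem two_mul_card_sierpV (n : ℕ) : 2 * (sierpV n).card = 3 ^ (n + 1) + 3 := by
  induction n with
  | zero =>
    have h01 : cornerPt 0 ≠ cornerPt 1 := cornerPt_injective.ne (by decide)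
    have h02 : cornerPt 0 ≠ cornerPt 2 := cornerPt_injective.ne (by decide)
    have h12 : cornerPt 1 ≠ cornerPt 2 := cornerPt_injective.ne (by decide)
    rw [sierpV, Finset.card_insert_of_notMem (by simp [h01, h02]), Finset.card_pair h12]
    norm_num
  | succ n ih =>
    have hcard (i : Fin 3) : ((sierpV n).image (psi i)).card = (sierpV n).card :=
      Finset.card_image_of_injective _ (psi_injective i)
    have hne : psi 0 (cornerPt 2) ≠ psi 1 (cornerPt 2) := by
      intro h
      have := congrArg (baryc 0) h
      rw [baryc_psi, baryc_psi] at this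
      norm_num at this
    have h01 := Finset.card_union_add_card_inter ((sierpV n).image (psi 0))
      ((sierpV n).image (psi 1))
    rw [image_psi_inter_image_psi n (by decide), Finset.card_singleton, hcard, hcard] at h01
    have h2 := Finset.card_union_add_card_inter
      ((sierpV n).image (psi 0) ∪ (sierpV n).image (psi 1)) ((sierpV n).image (psi 2))
    rw [Finset.union_inter_distrib_right, image_psi_inter_image_psi n (by decide),
      image_psi_inter_image_psi n (by decide), ← Finset.insert_eq, Finset.card_pair hne,
      hcard] at h2
    rw [sierpV, pow_succ]
    omega

theorem mem_sierpV_of_mem_sierpE {n : ℕ} {e : Sym2 Pt} (he : e ∈ sierpE n) {x : Pt}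
    (hx : x ∈ e) : x ∈ sierpV n := by
  induction n generalizing e x with
  | zero =>
    simp only [sierpE, Finset.mem_insert, Finset.mem_singleton] at he
    simp only [sierpV, Finset.mem_insert, Finset.mem_singleton]
    rcases he with rfl | rfl | rfl <;> rw [Sym2.mem_iff] at hx <;> tauto
  | succ n ih =>
    obtain ⟨i, e', he', rfl⟩ := mem_sierpE_succ.1 he
    obtain ⟨y, hy, rfl⟩ := Sym2.mem_map.1 hx
    exact mem_sierpV_succ.2 ⟨i, y, ih he' hy, rfl⟩

theorem not_isDiag_of_mem_sierpE {n : ℕ} {e : Sym2 Pt} (he : e ∈ sierpE n) : ¬ e.IsDiag := by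
  induction n generalizing e with
  | zero =>
    simp only [sierpE, Finset.mem_insert, Finset.mem_singleton] at he
    rcases he with rfl | rfl | rfl <;> rw [Sym2.mk_isDiag_iff] <;>
      exact cornerPt_injective.ne (by decide)
  | succ n ih =>
    obtain ⟨i, e', he', rfl⟩ := mem_sierpE_succ.1 he
    rw [Sym2.isDiag_map (psi_injective i)]
    exact ih he'

theorem map_psi_ne_map_psi {n : ℕ} {e e' : Sym2 Pt} (he : e ∈ sierpE n) (he' : e' ∈ sierpE n)
    {i j : Fin 3} (hij : i ≠ j) : Sym2.map (psi i) e ≠ Sym2.map (psi j) e' := by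
  intro h
  have key : ∀ x ∈ e, x = cornerPt j := by
    intro x hx
    have hx' : psi i x ∈ Sym2.map (psi j) e' := h ▸ Sym2.mem_map.2 ⟨x, hx, rfl⟩
    obtain ⟨y, hy, hxy⟩ := Sym2.mem_map.1 hx'
    exact eq_cornerPt_of_psi_eq (mem_sierpV_of_mem_sierpE he hx)
      (mem_sierpV_of_mem_sierpE he' hy) hij hxy.symm
  apply not_isDiag_of_mem_sierpE he
  induction e using Sym2.ind with
  | _ a b =>
    rw [Sym2.mk_isDiag_iff, key a (Sym2.mem_mk_left a b), key b (Sym2.mem_mk_right a b)]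

/-- The restriction of an edge set to a cell of the first level. -/
def restrictCell (i : Fin 3) (n : ℕ) (F : Finset (Sym2 Pt)) : Finset (Sym2 Pt) :=
  (sierpE n).filter fun e => Sym2.map (psi i) e ∈ F

theorem sum_card_restrictCell {n : ℕ} {F : Finset (Sym2 Pt)} (hF : F ⊆ sierpE (n + 1)) :
    ∑ i, (restrictCell i n F).card = F.card := by
  have hunion : F = Finset.univ.biUnion fun i =>
      (restrictCell i n F).image (Sym2.map (psi i)) := by
    ext e
    simp only [restrictCell, Finset.mem_biUnion, Finset.mem_univ, true_and, Finset.mem_image,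
      Finset.mem_filter]
    constructor
    · intro he
      obtain ⟨i, e', he', rfl⟩ := mem_sierpE_succ.1 (hF he)
      exact ⟨i, e', ⟨he', he⟩, rfl⟩
    · rintro ⟨i, e', ⟨-, he⟩, rfl⟩
      exact he
  conv_rhs => rw [hunion]
  rw [Finset.card_biUnion]
  · exact Finset.sum_congr rfl fun i _ =>
      (Finset.card_image_of_injective _ (Sym2.map.injective (psi_injective i))).symm
  · intro i _ j _ hij
    refine Finset.disjoint_left.2 fun e hi hj => ?_
    obtain ⟨e₁, h₁, rfl⟩ := Finset.mem_image.1 hi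
    obtain ⟨e₂, h₂, h⟩ := Finset.mem_image.1 hj
    exact map_psi_ne_map_psi (Finset.mem_filter.1 h₁).1 (Finset.mem_filter.1 h₂).1 hij h.symm

theorem psiWord_cons {k : ℕ} (i : Fin 3) (w : Fin k → Fin 3) :
    psiWord (Fin.cons i w : Fin (k + 1) → Fin 3) = psi i ∘ psiWord w := by
  simp [psiWord, List.ofFn_succ]

theorem psiWord_zero (w : Fin 0 → Fin 3) : psiWord w = id := by
  simp [psiWord]

theorem psiWord_injective {k : ℕ} (w : Fin k → Fin 3) : Function.Injective (psiWord w) := by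
  induction k with
  | zero => exact psiWord_zero w ▸ Function.injective_id
  | succ k ih =>
    rw [← Fin.cons_self_tail w, psiWord_cons]
    exact (psi_injective _).comp (ih _)

theorem map_psiWord_mem_sierpE {k n : ℕ} (w : Fin k → Fin 3) {e : Sym2 Pt} (he : e ∈ sierpE n) :
    Sym2.map (psiWord w) e ∈ sierpE (n + k) := by
  induction k with
  | zero => simpa [psiWord_zero] using he
  | succ k ih =>
    rw [← Fin.cons_self_tail w, psiWord_cons, ← Sym2.map_map]
    exact mem_sierpE_succ.2 ⟨_, _, ih _, rfl⟩

theorem restrictE_cons {k m : ℕ} (hk : k ≤ m) (i : Fin 3) (w : Fin k → Fin 3)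
    (F : Finset (Sym2 Pt)) :
    restrictE (Fin.cons i w : Fin (k + 1) → Fin 3) (m + 1) F =
      restrictE w m (restrictCell i m F) := by
  ext e
  simp only [restrictE, restrictCell, Finset.mem_filter, psiWord_cons, ← Sym2.map_map,
    Nat.add_sub_add_right]
  refine and_congr_right fun he => ⟨fun h => ⟨?_, h⟩, fun h => h.2⟩
  simpa [Nat.sub_add_cancel hk] using map_psiWord_mem_sierpE w he

theorem sum_card_restrictE {m k : ℕ} (hk : k ≤ m) {F : Finset (Sym2 Pt)} (hF : F ⊆ sierpE m) :
    ∑ w : Fin k → Fin 3, (restrictE w m F).card = F.card := by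
  induction k generalizing m F with
  | zero =>
    have hfilter : (sierpE m).filter (· ∈ F) = F := by
      rw [Finset.filter_mem_eq_inter, Finset.inter_eq_right.2 hF]
    simp [restrictE, psiWord_zero, hfilter]
  | succ k ih =>
    obtain ⟨m, rfl⟩ : ∃ n, m = n + 1 := ⟨m - 1, by omega⟩
    rw [← (Fin.consEquiv fun _ => Fin 3).sum_comp, Fintype.sum_prod_type,
      ← sum_card_restrictCell hF]
    refine Finset.sum_congr rfl fun i _ => ?_
    rw [← ih (F := restrictCell i m F) (Nat.le_of_succ_le_succ hk) (Finset.filter_subset _ _)]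
    exact Finset.sum_congr rfl fun w _ =>
      congrArg Finset.card (restrictE_cons (Nat.le_of_succ_le_succ hk) i w F)

theorem isAcyclic_restrictE {k m : ℕ} (w : Fin k → Fin 3) {F : Finset (Sym2 Pt)}
    (hF : (graphOf F).IsAcyclic) : (graphOf (restrictE w m F)).IsAcyclic := by
  refine SimpleGraph.IsAcyclic.comap ⟨psiWord w, fun {a b} hab => ?_⟩ (psiWord_injective w) hF
  simp only [graphOf, SimpleGraph.fromEdgeSet_adj, Finset.mem_coe, restrictE,
    Finset.mem_filter] at hab ⊢
  exact ⟨hab.1.2, (psiWord_injective w).ne hab.2⟩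

theorem ncomp_add_card {n : ℕ} {F : Finset (Sym2 Pt)} (hsub : F ⊆ sierpE n)
    (hF : (graphOf F).IsAcyclic) : ncomp n F + F.card = (sierpV n).card := by
  rw [← ncard_reachIn_add_card_edges (sierpV n) F
    (fun e he x hx => mem_sierpV_of_mem_sierpE (hsub he) hx)
    (fun e he => not_isDiag_of_mem_sierpE (hsub he)) hF, ncomp]
  congr 2
  ext C
  exact exists_congr fun v => and_congr_right fun _ => eq_comm

/-- component count of the restrictions of a spanning forest. -/
theorem component_sum (m k : ℕ) (hk : k ≤ m) (f : Finset (Sym2 Pt))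
    (hfsub : f ⊆ sierpE m) (hfacyclic : (graphOf f).IsAcyclic) (c : ℕ)
    (hc : ncomp m f = c) :
    (∑ w : Fin k → Fin 3, (ncomp (m - k) (restrictE w m f) : ℝ)) =
        3 / 2 * ((3 : ℝ) ^ k - 1) + c ∧
      (∑ w : Fin k → Fin 3, (3 - (ncomp (m - k) (restrictE w m f) : ℝ))) =
        3 / 2 * ((3 : ℝ) ^ k + 1) - c := by
  have hcell (w : Fin k → Fin 3) : (ncomp (m - k) (restrictE w m f) : ℝ) =
      (3 ^ (m - k + 1) + 3) / 2 - (restrictE w m f).card := by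
    have h := ncomp_add_card (Finset.filter_subset _ _) (isAcyclic_restrictE (m := m) w hfacyclic)
    have hV := two_mul_card_sierpV (m - k)
    rw [← h] at hV
    have hV' : 2 * ((ncomp (m - k) (restrictE w m f) : ℝ) + (restrictE w m f).card) =
        3 ^ (m - k + 1) + 3 := mod_cast hV
    linarith
  have hf : 2 * ((c : ℝ) + f.card) = 3 ^ (m + 1) + 3 := by
    have hV := two_mul_card_sierpV m
    rw [← ncomp_add_card hfsub hfacyclic, hc] at hV
    exact_mod_cast hV
  have hedges : ∑ w : Fin k → Fin 3, ((restrictE w m f).card : ℝ) = f.card :=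
    mod_cast sum_card_restrictE hk hfsub
  have hpow : (3 : ℝ) ^ k * 3 ^ (m - k + 1) = 3 ^ (m + 1) := by
    rw [← pow_add]
    congr 1
    omega
  have hsum : ∑ w : Fin k → Fin 3, (ncomp (m - k) (restrictE w m f) : ℝ) =
      3 / 2 * ((3 : ℝ) ^ k - 1) + c := by
    simp only [hcell, Finset.sum_sub_distrib, hedges, Finset.sum_const, Finset.card_univ,
      Fintype.card_fun, Fintype.card_fin, nsmul_eq_mul, Nat.cast_pow, Nat.cast_ofNat]
    linarith
  refine ⟨hsum, ?_⟩
  rw [Finset.sum_sub_distrib, hsum]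
  simp only [Finset.sum_const, Finset.card_univ, Fintype.card_fun, Fintype.card_fin,
    nsmul_eq_mul, Nat.cast_pow, Nat.cast_ofNat]
  ring

end
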